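/- Let S be an irreducible constraint, presented by an irreducible deterministic labeled graph G whose alphabet Σ is partitioned into nonempty sets Σ0 and Σ1, and let n0 and n1 be positive integers. Then for any (S,n0,n1)-encoder E, the number of states of E satisfies |V(E)| ≥ min over x ∈ X(A_{G_0},A_{G_1},n0,n1) of ‖x‖_∞, where ‖x‖_∞ denotes the maximum entry of x. -/

import Mathlib

open scoped Classical

/-- A finite labeled directed graph over alphabet `A`: a nonempty finite set of
states, a finite set of edges each with an initial and terminal state, and a
labeling of edges by symbols of `A`. -/
structure LGraph (A : Type u) where
  V : Type u
  [fintypeV : Fintype V]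
  [nonemptyV : Nonempty V]
  E : Type u
  [fintypeE : Fintype E]
  src : E → V
  dst : E → V
  lab : E → A

attribute [instance] LGraph.fintypeV LGraph.nonemptyV LGraph.fintypeE

namespace LGraph

variable {A : Type*}

/-- `G.IsWalk u es` : `es` is a sequence of consecutive edges starting at `u`. -/
def IsWalk (G : LGraph A) : G.V → List G.E → Prop
  | _, [] => True
  | u, e :: es => G.src e = u ∧ G.IsWalk (G.dst e) es

/-- The terminal state of a walk. -/
def endState (G : LGraph A) : G.V → List G.E → G.V
  | u, [] => u
  | _, e :: es => G.endState (G.dst e) es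

/-- The constraint `S(G)` presented by `G`: all words generated by finite paths. -/
def constraint (G : LGraph A) : Set (List A) :=
  { w | ∃ u es, G.IsWalk u es ∧ es.map G.lab = w }

/-- No state has two distinct outgoing edges with the same label. -/
def Deterministic (G : LGraph A) : Prop :=
  ∀ e e' : G.E, G.src e = G.src e' → G.lab e = G.lab e' → e = e'

/-- No two distinct paths with the same initial state and the same terminal
state generate the same word. -/
def Lossless (G : LGraph A) : Prop :=
  ∀ (u : G.V) (es es' : List G.E), G.IsWalk u es → G.IsWalk u es' →
    G.endState u es = G.endState u es' → es.map G.lab = es'.map G.lab → es = es'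

/-- Strong connectivity. -/
def Irreducible (G : LGraph A) : Prop :=
  ∀ u v : G.V, ∃ es : List G.E, G.IsWalk u es ∧ G.endState u es = v

/-- Primitivity (in the equivalent form: some power of the adjacency matrix is
entrywise positive, i.e. there is a uniform positive length `ℓ` such that any
state can be reached from any state by a walk of length `ℓ`). -/
def Primitive (G : LGraph A) : Prop :=
  ∃ ℓ : ℕ, 0 < ℓ ∧ ∀ u v : G.V, ∃ es : List G.E,
    G.IsWalk u es ∧ es.length = ℓ ∧ G.endState u es = v

/-- The adjacency matrix of the subgraph of `G` consisting of the edges whose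
labels lie in `P`: its `(u,v)` entry is the number of edges from `u` to `v`
with label in `P`. -/
noncomputable def subAdj (G : LGraph A) (P : Set A) : G.V → G.V → ℕ :=
  fun u v => Nat.card {e : G.E // G.src e = u ∧ G.dst e = v ∧ G.lab e ∈ P}

/-- Every state has exactly `n` outgoing edges with label in `P`. -/
def OutDeg (G : LGraph A) (P : Set A) (n : ℕ) : Prop :=
  ∀ u : G.V, Nat.card {e : G.E // G.src e = u ∧ G.lab e ∈ P} = n

/-- An `(S, n0, n1)`-encoder with respect to the even/odd symbol sets `S0, S1`:
a lossless graph whose constraint is contained in `S` and in which every state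
has exactly `n0` outgoing edges with even labels and exactly `n1` outgoing
edges with odd labels. -/
def IsEncoder (En : LGraph A) (S : Set (List A)) (S0 S1 : Set A) (n0 n1 : ℕ) : Prop :=
  En.Lossless ∧ En.constraint ⊆ S ∧ En.OutDeg S0 n0 ∧ En.OutDeg S1 n1

/-- `x ∈ X(A_{G_0}, A_{G_1}, n0, n1)`: a nonnegative nonzero integer vector with
`A_{G_0} x ≥ n0 x` and `A_{G_1} x ≥ n1 x` componentwise. -/
def InX (G : LGraph A) (S0 S1 : Set A) (n0 n1 : ℕ) (x : G.V → ℕ) : Prop :=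
  x ≠ 0 ∧ (∀ u, n0 * x u ≤ ∑ v, G.subAdj S0 u v * x v)
        ∧ (∀ u, n1 * x u ≤ ∑ v, G.subAdj S1 u v * x v)

/-- The graph has anticipation at most `a`: all paths from a common state that
generate the same word of length `a+1` share the same first edge. -/
def AnticipationAtMost (G : LGraph A) (a : ℕ) : Prop :=
  ∀ (u : G.V) (es es' : List G.E), G.IsWalk u es → G.IsWalk u es' →
    es.length = a + 1 → es'.length = a + 1 → es.map G.lab = es'.map G.lab →
    es.head? = es'.head?

/-- The graph has memory at most `μ`: all paths of length `μ` generating the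
same word terminate in the same state. -/
def MemoryAtMost (G : LGraph A) (μ : ℕ) : Prop :=
  ∀ (u u' : G.V) (es es' : List G.E), G.IsWalk u es → G.IsWalk u' es' →
    es.length = μ → es'.length = μ → es.map G.lab = es'.map G.lab →
    G.endState u es = G.endState u' es'

/-- `(m,a)`-definiteness: all paths generating a given word of length `m+a+1`
share the same `(m+1)`-st edge. -/
def Definite (G : LGraph A) (m a : ℕ) : Prop :=
  ∀ (u u' : G.V) (es es' : List G.E), G.IsWalk u es → G.IsWalk u' es' →
    es.length = m + a + 1 → es'.length = m + a + 1 → es.map G.lab = es'.map G.lab →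
    es[m]? = es'[m]?

end LGraph

namespace LGraph

variable {A : Type*}

theorem isWalk_append (G : LGraph A) (u : G.V) (es fs : List G.E) :
    G.IsWalk u (es ++ fs) ↔ G.IsWalk u es ∧ G.IsWalk (G.endState u es) fs := by
  induction es generalizing u with
  | nil => simp [IsWalk, endState]
  | cons e es ih => simp [IsWalk, endState, ih, and_assoc]

theorem endState_append (G : LGraph A) (u : G.V) (es fs : List G.E) :
    G.endState u (es ++ fs) = G.endState (G.endState u es) fs := by
  induction es generalizing u with
  | nil => rfl
  | cons e es ih => exact ih _

theorem Deterministic.walk_unique {G : LGraph A} (hG : G.Deterministic) {u : G.V}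
    {es fs : List G.E} (hes : G.IsWalk u es) (hfs : G.IsWalk u fs)
    (h : es.map G.lab = fs.map G.lab) : es = fs := by
  induction es generalizing u fs with
  | nil => simpa using h.symm
  | cons e es ih =>
    cases fs with
    | nil => simp at h
    | cons f fs =>
      simp only [List.map_cons, List.cons.injEq] at h
      obtain rfl : e = f := hG e f (hes.1.trans hfs.1.symm) h.1
      rw [ih hes.2 hfs.2 h.2]

/-- The word `w` is generated by a path starting at `u`. -/
def Generates (G : LGraph A) (u : G.V) (w : List A) : Prop :=
  ∃ es, G.IsWalk u es ∧ es.map G.lab = w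

/-- The terminal states of the paths that start in `u` and generate `w`. -/
noncomputable def reach (G : LGraph A) (u : G.V) (w : List A) : Finset G.V :=
  {v | ∃ es, G.IsWalk u es ∧ es.map G.lab = w ∧ G.endState u es = v}

/-- The terminal states of all paths that generate `w`. -/
noncomputable def reachAll (G : LGraph A) (w : List A) : Finset G.V :=
  {v | ∃ u, v ∈ G.reach u w}

theorem mem_reach {G : LGraph A} {u v : G.V} {w : List A} :
    v ∈ G.reach u w ↔ ∃ es, G.IsWalk u es ∧ es.map G.lab = w ∧ G.endState u es = v := by
  simp [reach]

theorem mem_reachAll {G : LGraph A} {v : G.V} {w : List A} :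
    v ∈ G.reachAll w ↔ ∃ u, v ∈ G.reach u w := by
  simp [reachAll]

theorem Generates.reach_nonempty {G : LGraph A} {u : G.V} {w : List A}
    (h : G.Generates u w) : (G.reach u w).Nonempty := by
  obtain ⟨es, h1, h2⟩ := h
  exact ⟨_, mem_reach.2 ⟨es, h1, h2, rfl⟩⟩

/-- Every continuation of the word `w` generated from the state `s` of `H` is generated
from the state `u` of `G`. -/
def Follows (H G : LGraph A) (s : H.V) (w : List A) (u : G.V) : Prop :=
  ∀ w', H.Generates s (w ++ w') → G.Generates u w'

theorem Follows.step {H G : LGraph A} (hG : G.Deterministic) {s : H.V} {w : List A}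
    {f : G.E} (h : Follows H G s w (G.src f)) :
    Follows H G s (w ++ [G.lab f]) (G.dst f) := by
  intro w' hw'
  rw [List.append_assoc] at hw'
  obtain ⟨fs, hfs, hlab⟩ := h _ hw'
  cases fs with
  | nil => simp at hlab
  | cons f' fs =>
    simp only [List.map_cons, List.singleton_append, List.cons.injEq] at hlab
    obtain rfl : f' = f := hG _ _ hfs.1 hlab.1
    exact ⟨fs, hfs.2, hlab.2⟩

theorem mem_reachAll_append {G : LGraph A} {v : G.V} {w w' : List A}
    (h : v ∈ G.reachAll (w ++ w')) : ∃ u ∈ G.reachAll w, v ∈ G.reach u w' := by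
  obtain ⟨u, hu⟩ := mem_reachAll.1 h
  obtain ⟨es, h1, h2, h3⟩ := mem_reach.1 hu
  obtain ⟨es₁, es₂, rfl, h4, h5⟩ := List.map_eq_append_iff.1 h2
  rw [isWalk_append] at h1
  rw [endState_append] at h3
  exact ⟨G.endState u es₁, mem_reachAll.2 ⟨u, mem_reach.2 ⟨es₁, h1.1, h4, rfl⟩⟩,
    mem_reach.2 ⟨es₂, h1.2, h5, h3⟩⟩

theorem exists_follows {H G : LGraph A} (hG : G.Deterministic)
    (hsub : H.constraint ⊆ G.constraint) (s : H.V) :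
    ∃ w u, H.Generates s w ∧ Follows H G s w u := by
  obtain ⟨w, hw, hmin⟩ := exists_minimalFor_of_wellFoundedLT (H.Generates s)
    (fun w => (G.reachAll w).card) ⟨[], [], trivial, rfl⟩
  have hne : (G.reachAll w).Nonempty := by
    obtain ⟨es, h1, h2⟩ := hw
    obtain ⟨u, fs, h3, h4⟩ := hsub ⟨s, es, h1, h2⟩
    exact ⟨G.endState u fs, mem_reachAll.2 ⟨u, mem_reach.2 ⟨fs, h3, h4, rfl⟩⟩⟩
  obtain ⟨u, hu⟩ := hne
  refine ⟨w, u, hw, fun w' hw' => ?_⟩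
  have hcard : (G.reachAll w).card ≤ (G.reachAll (w ++ w')).card := by
    by_contra! hlt
    exact absurd (hmin hw' hlt.le) (not_le.2 hlt)
  choose! g hg hgr using fun v (hv : v ∈ G.reachAll (w ++ w')) => mem_reachAll_append hv
  have hinj : Set.InjOn g (G.reachAll (w ++ w')) := by
    intro v hv v' hv' hgv
    obtain ⟨es, h1, h2, h3⟩ := mem_reach.1 (hgr v hv)
    obtain ⟨es', h1', h2', h3'⟩ := mem_reach.1 (hgr v' hv')
    rw [← hgv] at h1' h3'
    rw [← h3, ← h3', hG.walk_unique h1 h1' (h2.trans h2'.symm)]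
  obtain ⟨v, hv, rfl⟩ := Finset.surjOn_of_injOn_of_card_le g hg hinj hcard hu
  obtain ⟨es, h1, h2, -⟩ := mem_reach.1 (hgr v hv)
  exact ⟨es, h1, h2⟩

/-- The edges leaving the states of `reach s w` are determined by their label and their
terminal state. -/
theorem Lossless.edge_unique {H : LGraph A} (hH : H.Lossless) {s : H.V} {w : List A}
    {e e' : H.E} (he : H.src e ∈ H.reach s w) (he' : H.src e' ∈ H.reach s w)
    (hlab : H.lab e = H.lab e') (hdst : H.dst e = H.dst e') : e = e' := by
  obtain ⟨es, h1, h2, h3⟩ := mem_reach.1 he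
  obtain ⟨es', h1', h2', h3'⟩ := mem_reach.1 he'
  have := hH s (es ++ [e]) (es' ++ [e'])
    ((isWalk_append ..).2 ⟨h1, h3.symm, trivial⟩)
    ((isWalk_append ..).2 ⟨h1', h3'.symm, trivial⟩)
    (by simpa [endState_append, endState] using hdst)
    (by simp [h2, h2', hlab])
  simpa using List.append_inj_right' this rfl

theorem dst_mem_reach {H : LGraph A} {s : H.V} {w : List A} {e : H.E}
    (he : H.src e ∈ H.reach s w) : H.dst e ∈ H.reach s (w ++ [H.lab e]) := by
  obtain ⟨es, h1, h2, h3⟩ := mem_reach.1 he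
  exact mem_reach.2 ⟨es ++ [e], (isWalk_append ..).2 ⟨h1, h3.symm, trivial⟩,
    by simp [h2], by simp [endState_append, endState]⟩

theorem OutDeg.card_edges {H : LGraph A} {P : Set A} {n : ℕ} (h : H.OutDeg P n)
    (T : Finset H.V) :
    ({e | H.src e ∈ T ∧ H.lab e ∈ P} : Finset H.E).card = n * T.card := by
  have hmaps : ∀ e ∈ ({e | H.src e ∈ T ∧ H.lab e ∈ P} : Finset H.E), H.src e ∈ T := by
    simp +contextual
  rw [Finset.card_eq_sum_card_fiberwise hmaps, mul_comm, ← smul_eq_mul,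
    ← Finset.sum_const]
  refine Finset.sum_congr rfl fun v hv => ?_
  rw [← h v, Nat.card_eq_fintype_card, Fintype.card_subtype, Finset.filter_filter]
  congr 1
  ext e
  simp only [Finset.mem_filter, Finset.mem_univ, true_and]
  constructor
  · rintro ⟨⟨-, h2⟩, h3⟩
    exact ⟨h3, h2⟩
  · rintro ⟨rfl, h2⟩
    exact ⟨⟨hv, h2⟩, rfl⟩

theorem sum_subAdj_mul (G : LGraph A) (P : Set A) (u : G.V) (x : G.V → ℕ) :
    ∑ v, G.subAdj P u v * x v = ∑ f : G.E with G.src f = u ∧ G.lab f ∈ P, x (G.dst f) := by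
  rw [← Finset.sum_fiberwise _ G.dst]
  refine Finset.sum_congr rfl fun v _ => ?_
  rw [Finset.sum_congr rfl (g := fun _ => x v)
    (fun f hf => by rw [(Finset.mem_filter.1 hf).2]), Finset.sum_const, smul_eq_mul, subAdj,
    Nat.card_eq_fintype_card, Fintype.card_subtype, Finset.filter_filter]
  congr 2
  ext f
  simp only [Finset.mem_filter, Finset.mem_univ, true_and]
  tauto

theorem Follows.mul_card_reach_le {H G : LGraph A}
    (hH : H.Lossless) {P : Set A} {n : ℕ} (hdeg : H.OutDeg P n) {s : H.V} {w : List A}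
    {u : G.V} (h : Follows H G s w u) :
    n * (H.reach s w).card ≤
      ∑ f : G.E with G.src f = u ∧ G.lab f ∈ P, (H.reach s (w ++ [G.lab f])).card := by
  rw [← hdeg.card_edges, ← Finset.card_sigma]
  have hedge : ∀ e : H.E, H.src e ∈ H.reach s w → ∃ f, G.src f = u ∧ G.lab f = H.lab e := by
    intro e he
    obtain ⟨es, h1, h2, h3⟩ := mem_reach.1 he
    obtain ⟨fs, hfs, hlab⟩ := h [H.lab e] ⟨es ++ [e],
      (isWalk_append ..).2 ⟨h1, h3.symm, trivial⟩, by simp [h2]⟩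
    cases fs with
    | nil => simp at hlab
    | cons f fs => exact ⟨f, hfs.1, by simp at hlab; exact hlab.1⟩
  rcases isEmpty_or_nonempty G.E with hG0 | hG0
  · rw [Finset.filter_eq_empty_iff.2 fun e _ he => hG0.false (hedge e he.1).choose]
    exact Nat.zero_le _
  choose! g hgs hgl using hedge
  refine Finset.card_le_card_of_injOn (fun e => ⟨g e, H.dst e⟩) ?_ ?_
  · intro e he
    obtain ⟨he1, he2⟩ : H.src e ∈ H.reach s w ∧ H.lab e ∈ P := by simpa using he
    simpa [hgs e he1, hgl e he1, he2] using dst_mem_reach he1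
  · intro e he e' he' heq
    obtain ⟨he1, -⟩ : H.src e ∈ H.reach s w ∧ H.lab e ∈ P := by simpa using he
    obtain ⟨he1', -⟩ : H.src e' ∈ H.reach s w ∧ H.lab e' ∈ P := by simpa using he'
    simp only [Sigma.mk.injEq, heq_eq_eq] at heq
    refine hH.edge_unique he1 he1' ?_ heq.2
    rw [← hgl e he1, ← hgl e' he1', heq.1]

/-- The largest size of a set `reach s w` all of whose continuations are generated
from `u`. -/
noncomputable def maxReach (H G : LGraph A) (s : H.V) (u : G.V) : ℕ :=
  sSup {m | ∃ w, Follows H G s w u ∧ m = (H.reach s w).card}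

theorem bddAbove_card_reach (H G : LGraph A) (s : H.V) (u : G.V) :
    BddAbove {m | ∃ w, Follows H G s w u ∧ m = (H.reach s w).card} := by
  refine ⟨Fintype.card H.V, ?_⟩
  rintro _ ⟨w, -, rfl⟩
  exact Finset.card_le_univ _

theorem Follows.card_reach_le_maxReach {H G : LGraph A} {s : H.V} {w : List A} {u : G.V}
    (h : Follows H G s w u) : (H.reach s w).card ≤ maxReach H G s u :=
  le_csSup (bddAbove_card_reach H G s u) ⟨w, h, rfl⟩

theorem maxReach_eq_zero_or (H G : LGraph A) (s : H.V) (u : G.V) :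
    maxReach H G s u = 0 ∨
      ∃ w, Follows H G s w u ∧ maxReach H G s u = (H.reach s w).card := by
  rcases Set.eq_empty_or_nonempty
    {m | ∃ w, Follows H G s w u ∧ m = (H.reach s w).card} with h | h
  · left
    rw [maxReach, h, csSup_empty, bot_eq_zero]
  · exact Or.inr (Nat.sSup_mem h (bddAbove_card_reach H G s u))

theorem mul_maxReach_le {H G : LGraph A} (hG : G.Deterministic) (hH : H.Lossless)
    {P : Set A} {n : ℕ} (hdeg : H.OutDeg P n) (s : H.V) (u : G.V) :
    n * maxReach H G s u ≤ ∑ v, G.subAdj P u v * maxReach H G s v := by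
  rcases maxReach_eq_zero_or H G s u with h0 | ⟨w, hw, hcard⟩
  · simp [h0]
  · rw [hcard, sum_subAdj_mul]
    refine (hw.mul_card_reach_le hH hdeg).trans (Finset.sum_le_sum fun f hf => ?_)
    obtain ⟨rfl, -⟩ := (Finset.mem_filter.1 hf).2
    exact (hw.step hG).card_reach_le_maxReach

end LGraph

/-- For any `(S,n0,n1)`-encoder `En`, the number of states of
`En` is at least `min_{x ∈ X(A_{G_0},A_{G_1},n0,n1)} ‖x‖_∞`. -/
theorem bimodal_encoder_states_lower_bound {A : Type*} (G : LGraph A) (S0 S1 : Set A)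
    (hS0 : S0.Nonempty) (hS1 : S1.Nonempty) (hdisj : Disjoint S0 S1)
    (hcover : S0 ∪ S1 = Set.univ)
    (hdet : G.Deterministic) (hirr : G.Irreducible)
    (n0 n1 : ℕ) (hn0 : 0 < n0) (hn1 : 0 < n1)
    (En : LGraph A) (hEn : LGraph.IsEncoder En G.constraint S0 S1 n0 n1) :
    sInf {m : ℕ | ∃ x : G.V → ℕ, G.InX S0 S1 n0 n1 x ∧ m = Finset.univ.sup x}
      ≤ Nat.card En.V := by
  obtain ⟨hH, hsub, hdeg0, hdeg1⟩ := hEn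
  obtain ⟨s⟩ := En.nonemptyV
  have hX : G.InX S0 S1 n0 n1 (LGraph.maxReach En G s) := by
    refine ⟨?_, LGraph.mul_maxReach_le hdet hH hdeg0 s, LGraph.mul_maxReach_le hdet hH hdeg1 s⟩
    obtain ⟨w, u, hw, hwu⟩ := LGraph.exists_follows hdet hsub s
    intro h0
    have hle := hwu.card_reach_le_maxReach
    rw [h0] at hle
    exact absurd hle (not_le.2 hw.reach_nonempty.card_pos)
  refine le_trans (Nat.sInf_le ?_)
    (Finset.sup_le (s := Finset.univ) (f := LGraph.maxReach En G s) fun u _ => ?_)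
  · exact ⟨_, hX, rfl⟩
  rw [Nat.card_eq_fintype_card]
  rcases LGraph.maxReach_eq_zero_or En G s u with h0 | ⟨w, -, hcard⟩
  · simp [h0]
  · exact hcard ▸ Finset.card_le_univ _
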